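/- arXiv:1603.07812 — 3 statements merged into one kernel-verified Lean document; each statement's English description precedes it below -/
import Mathlib

section
/- Let T₁, …, T_d be pairwise commuting unital positive contractions of L¹(μ), and suppose there exist multi-indices m ∈ ℕ₀^d, k ∈ ℕ₀^d and a positive contraction S on L¹(μ) such that T^{m+k} ≥ S, T^m ≥ S, ‖T^{m+k} − S‖ < 1, and ‖T^m − S‖ < 1, where T^n := T₁^{n₁}⋯T_d^{n_d}. Then ‖T^{n+k} − T^n‖ → 0 as n → ∞ (i.e., as min_i n_i → ∞). -/
open MeasureTheory Filter

/-- `T^n := T₁^{n₁} ⋯ T_d^{n_d}` for a multi-index `n`. -/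
noncomputable def multiPow {X : Type*} [MeasurableSpace X] {μ : Measure X} {d : ℕ}
    (T : Fin d → (Lp ℝ 1 μ →L[ℝ] Lp ℝ 1 μ)) (n : Fin d → ℕ) :
    Lp ℝ 1 μ →L[ℝ] Lp ℝ 1 μ :=
  (List.ofFn fun i => (T i) ^ (n i)).prod

section Ring
variable {A : Type*} [NormedRing A]

lemma z_norm_pow_le (h1 : ‖(1 : A)‖ ≤ 1) (R : A) (r : ℝ) (hr : ‖R‖ ≤ r) (n : ℕ) :
    ‖R ^ n‖ ≤ r ^ n := by
  have hr0 : 0 ≤ r := (norm_nonneg _).trans hr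
  induction n with
  | zero => simpa using h1
  | succ n ih =>
    rw [pow_succ, pow_succ]
    exact (norm_mul_le _ _).trans (mul_le_mul ih hr (norm_nonneg _) (by positivity))

lemma z_rem (h1 : ‖(1 : A)‖ ≤ 1) (W E Q R : A) (ε : ℝ) (hW : W = E * Q + R)
    (hc : Commute W E) (hQn : ‖Q‖ ≤ 1) (hWn : ‖W‖ ≤ 1) (hEn : ‖E‖ ≤ 1) (hR : ‖R‖ ≤ ε) (j : ℕ) :
    ‖W ^ j - E ^ j * Q ^ j‖ ≤ j * ε := by
  induction j with
  | zero => simp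
  | succ j ih =>
    have hc' : W * E ^ j = E ^ j * W := hc.pow_right j
    have e : W ^ (j + 1) - E ^ (j + 1) * Q ^ (j + 1)
        = W * (W ^ j - E ^ j * Q ^ j) + E ^ j * R * Q ^ j := by
      have : R = W - E * Q := by rw [hW]; abel
      rw [this, mul_sub, ← mul_assoc W (E ^ j), hc', pow_succ' W, pow_succ E, pow_succ' Q]
      noncomm_ring
    have hE : ‖E ^ j‖ ≤ 1 := by simpa using z_norm_pow_le h1 E 1 hEn j
    have hQ : ‖Q ^ j‖ ≤ 1 := by simpa using z_norm_pow_le h1 Q 1 hQn j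
    have hε : 0 ≤ ε := (norm_nonneg _).trans hR
    have b1 : ‖W * (W ^ j - E ^ j * Q ^ j)‖ ≤ j * ε := by
      refine (norm_mul_le _ _).trans ?_
      calc _ ≤ 1 * (j * ε) := mul_le_mul hWn ih (norm_nonneg _) zero_le_one
        _ = _ := one_mul _
    have b2 : ‖E ^ j * R * Q ^ j‖ ≤ ε := by
      refine (norm_mul_le _ _).trans ?_
      calc _ ≤ (1 * ε) * 1 := by
            refine mul_le_mul ((norm_mul_le _ _).trans ?_) hQ (norm_nonneg _) (by positivity)
            exact mul_le_mul hE hR (norm_nonneg _) zero_le_one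
        _ = ε := by ring
    rw [e]
    refine (norm_add_le _ _).trans ?_
    push_cast
    linarith

lemma z_sum_abs (p : ℕ) :
    ∑ i ∈ Finset.range (2 * p), |((2 * p).choose (i + 1) : ℝ) - (2 * p).choose i|
      = 2 * (Nat.centralBinom p : ℝ) - 2 := by
  rw [two_mul p, Finset.sum_range_add, ← two_mul p]
  have a1 : ∑ i ∈ Finset.range p, |((2 * p).choose (i + 1) : ℝ) - (2 * p).choose i|
      = (2 * p).choose p - 1 := by
    rw [Finset.sum_congr rfl (g := fun i => ((2 * p).choose (i + 1) : ℝ) - (2 * p).choose i)]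
    · rw [Finset.sum_range_sub (fun i => ((2 * p).choose i : ℝ))]; simp
    · intro i hi
      rw [abs_of_nonneg]
      have := Nat.choose_le_succ_of_lt_half_left (r := i) (n := 2 * p)
        (by simp at hi; omega)
      rw [sub_nonneg]; exact_mod_cast this
  have a2 : ∑ i ∈ Finset.range p,
      |((2 * p).choose (p + i + 1) : ℝ) - (2 * p).choose (p + i)|
      = (2 * p).choose p - 1 := by
    rw [Finset.sum_congr rfl
      (g := fun i => ((2 * p).choose (p + i) : ℝ) - (2 * p).choose (p + (i + 1)))]
    · rw [Finset.sum_range_sub' (fun i => ((2 * p).choose (p + i) : ℝ))]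
      simp [← two_mul]
    · intro i hi
      simp at hi
      rw [abs_sub_comm, abs_of_nonneg]
      · rfl
      have := Nat.choose_le_succ_of_lt_half_left (r := p - (i + 1)) (n := 2 * p)
        (by omega)
      rw [← Nat.choose_symm (by omega : p - (i + 1) ≤ 2 * p),
        ← Nat.choose_symm (by omega : p - (i + 1) + 1 ≤ 2 * p)] at this
      rw [show 2 * p - (p - (i + 1)) = p + i + 1 by omega,
        show 2 * p - (p - (i + 1) + 1) = p + i by omega] at this
      rw [sub_nonneg]; exact_mod_cast this
  rw [a1, a2, Nat.centralBinom]; ring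

variable [NormedAlgebra ℝ A]

lemma z_abel (c : ℕ → ℝ) (K : A) (n : ℕ) :
    (1 - K) * ∑ i ∈ Finset.range (n + 1), c i • K ^ i
      = c 0 • 1 + ∑ i ∈ Finset.range n, (c (i + 1) - c i) • K ^ (i + 1) - c n • K ^ (n + 1) := by
  induction n with
  | zero => simp [smul_sub]
  | succ n ih =>
    rw [Finset.sum_range_succ, mul_add, ih, Finset.sum_range_succ, sub_mul, one_mul,
      mul_smul_comm, ← pow_succ', sub_smul]
    abel

lemma z_binom (h1 : ‖(1 : A)‖ ≤ 1) (K : A) (hK : ‖K‖ ≤ 1) (p : ℕ) :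
    ‖(1 - K) * ((1 / 2 : ℝ) • (1 + K)) ^ (2 * p)‖ ≤ 2 * ((Nat.centralBinom p : ℝ) / 4 ^ p) := by
  have hKn : ∀ n, ‖K ^ n‖ ≤ 1 := fun n => by simpa using z_norm_pow_le h1 K 1 hK n
  have e : (1 + K) ^ (2 * p)
      = ∑ i ∈ Finset.range (2 * p + 1), ((2 * p).choose i : ℝ) • K ^ i := by
    rw [add_comm, (Commute.one_right K).add_pow]
    refine Finset.sum_congr rfl fun i _ => ?_
    rw [one_pow, mul_one, Nat.cast_smul_eq_nsmul, nsmul_eq_mul, Nat.cast_comm]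
  have hb : ∀ (c : ℝ) n, ‖c • K ^ n‖ ≤ |c| := fun c n => by
    rw [norm_smul, Real.norm_eq_abs]
    exact mul_le_of_le_one_right (abs_nonneg _) (hKn n)
  have key : ‖(1 - K) * (1 + K) ^ (2 * p)‖ ≤ 2 * (Nat.centralBinom p : ℝ) := by
    rw [e, z_abel (fun i => ((2 * p).choose i : ℝ))]
    refine (norm_sub_le _ _).trans ?_
    have t1 := norm_add_le (((2 * p).choose 0 : ℝ) • (1 : A)) (∑ i ∈ Finset.range (2 * p),
      (((2 * p).choose (i + 1) : ℝ) - (2 * p).choose i) • K ^ (i + 1))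
    have t2 := norm_sum_le_of_le (Finset.range (2 * p))
      (fun i _ => hb (((2 * p).choose (i + 1) : ℝ) - (2 * p).choose i) (i + 1))
    rw [z_sum_abs] at t2
    have t3 := hb ((2 * p).choose (2 * p)) (2 * p + 1)
    have t4 := hb ((2 * p).choose 0) 0
    simp only [pow_zero, Nat.choose_self, Nat.choose_zero_right, Nat.cast_one, abs_one] at *
    linarith
  rw [smul_pow, mul_smul_comm, norm_smul, pow_mul]
  have : ‖((1 / 2 : ℝ) ^ 2) ^ p‖ = 1 / 4 ^ p := by
    rw [Real.norm_of_nonneg (by positivity), ← one_div_pow]; norm_num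
  rw [this]
  calc _ ≤ 1 / 4 ^ p * (2 * (Nat.centralBinom p : ℝ)) := by gcongr
    _ = _ := by ring

lemma z_cb_sq (p : ℕ) : ((Nat.centralBinom p : ℝ) / 4 ^ p) ^ 2 * (2 * p + 1) ≤ 1 := by
  induction p with
  | zero => simp
  | succ p ih =>
    have h := Nat.succ_mul_centralBinom_succ p
    have h' : ((p : ℝ) + 1) * (Nat.centralBinom (p + 1) : ℝ)
        = 2 * (2 * p + 1) * Nat.centralBinom p := by exact_mod_cast h
    have e : (Nat.centralBinom (p + 1) : ℝ) / 4 ^ (p + 1)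
        = (Nat.centralBinom p : ℝ) / 4 ^ p * ((2 * p + 1) / (2 * p + 2)) := by
      have : (Nat.centralBinom (p + 1) : ℝ) = 2 * (2 * p + 1) * Nat.centralBinom p / (p + 1) := by
        field_simp; linarith
      rw [this, pow_succ]; field_simp; ring
    rw [e]
    set c := (Nat.centralBinom p : ℝ) / 4 ^ p
    have : (c * ((2 * p + 1) / (2 * p + 2))) ^ 2 * (2 * ((p + 1 : ℕ) : ℝ) + 1)
        = (c ^ 2 * (2 * p + 1)) * ((2 * p + 1) * (2 * p + 3) / (2 * p + 2) ^ 2) := by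
      push_cast; field_simp; ring
    rw [this]
    refine mul_le_one₀ ih (by positivity) ?_
    rw [div_le_one (by positivity)]
    nlinarith

lemma z_cb_tendsto : Tendsto (fun p : ℕ => 2 * ((Nat.centralBinom p : ℝ) / 4 ^ p)) atTop (nhds 0) := by
  have h : Tendsto (fun p : ℕ => ((Nat.centralBinom p : ℝ) / 4 ^ p) ^ 2) atTop (nhds 0) := by
    refine squeeze_zero (fun p => by positivity) (fun p => ?_)
      tendsto_one_div_add_atTop_nhds_zero_nat
    have := z_cb_sq p
    rw [le_div_iff₀ (by positivity)]
    refine le_trans ?_ this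
    gcongr
    linarith [(Nat.cast_nonneg p : (0:ℝ) ≤ p)]
  have h2 := (h.sqrt).const_mul 2
  simp only [Real.sqrt_zero, mul_zero] at h2
  refine h2.congr fun p => ?_
  rw [Real.sqrt_sq (by positivity)]

end Ring

lemma z_ofFn_mul {M : Type*} [Monoid M] {d : ℕ} (T : Fin d → M)
    (hc : ∀ i j, Commute (T i) (T j)) (a b : Fin d → ℕ) :
    (List.ofFn fun i => T i ^ ((a + b) i)).prod
      = (List.ofFn fun i => T i ^ (a i)).prod * (List.ofFn fun i => T i ^ (b i)).prod := by
  induction d with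
  | zero => simp
  | succ d ih =>
    have := ih (fun i => T i.succ) (fun i j => hc _ _) (fun i => a i.succ) (fun i => b i.succ)
    simp only [Pi.add_apply] at this
    simp only [List.ofFn_succ, List.prod_cons, Pi.add_apply]
    rw [this, pow_add]
    have c : Commute (T 0 ^ b 0) (List.ofFn fun i : Fin d => T i.succ ^ (a i.succ)).prod := by
      refine Commute.list_prod_right _ _ fun x hx => ?_
      rw [List.mem_ofFn] at hx
      obtain ⟨i, rfl⟩ := hx
      exact (hc _ _).pow_pow _ _
    simp only [mul_assoc]
    rw [← mul_assoc (T 0 ^ b 0), c.eq]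
    simp only [mul_assoc]

section Op
variable {X : Type*} [MeasurableSpace X] {μ : Measure X}

lemma z_norm_eq (f : Lp ℝ 1 μ) (hf : 0 ≤ f) : ‖f‖ = L1.integral f := by
  rw [L1.integral_eq_integral, L1.norm_eq_integral_norm]
  refine integral_congr_ae ?_
  have := (Lp.coeFn_nonneg f).2 hf
  filter_upwards [this] with x hx
  exact Real.norm_of_nonneg hx

lemma z_norm_le (P : Lp ℝ 1 μ →L[ℝ] Lp ℝ 1 μ) (hP : ∀ f, 0 ≤ f → 0 ≤ P f) (c : ℝ) (hc : 0 ≤ c)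
    (h : ∀ f, 0 ≤ f → L1.integral (P f) ≤ c * L1.integral f) : ‖P‖ ≤ c := by
  refine P.opNorm_le_bound hc fun f => ?_
  have ha : 0 ≤ |f| := abs_nonneg f
  have h1 : |P f| ≤ |P (abs f)| := by
    rw [abs_of_nonneg (hP _ ha)]
    refine sup_le ?_ ?_
    · have := hP (|f| - f) (sub_nonneg.2 (le_abs_self f))
      rw [map_sub] at this
      exact sub_nonneg.1 this
    · have := hP (|f| - -f) (sub_nonneg.2 (neg_le_abs f))
      rw [map_sub, map_neg] at this
      exact sub_nonneg.1 this
  calc ‖P f‖ ≤ ‖P |f|‖ := norm_le_norm_of_abs_le_abs h1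
    _ = L1.integral (P |f|) := z_norm_eq _ (hP _ ha)
    _ ≤ c * L1.integral |f| := h _ ha
    _ = c * ‖f‖ := by rw [← z_norm_eq _ ha, norm_abs_eq_norm]

lemma z_smul (f : Lp ℝ 1 μ) (hf : 0 ≤ f) : 0 ≤ (1 / 2 : ℝ) • f := by
  rw [← Lp.coeFn_nonneg] at hf ⊢
  filter_upwards [hf, Lp.coeFn_smul (1 / 2 : ℝ) f] with x hx h2
  rw [h2]
  simp only [Pi.smul_apply, smul_eq_mul, Pi.zero_apply] at *
  positivity

/-- Markov operators. -/
def ZGood (P : Lp ℝ 1 μ →L[ℝ] Lp ℝ 1 μ) : Prop :=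
  (∀ f, 0 ≤ f → 0 ≤ P f) ∧ (∀ f, L1.integral (P f) = L1.integral f)

lemma ZGood.norm_le {P : Lp ℝ 1 μ →L[ℝ] Lp ℝ 1 μ} (h : ZGood P) : ‖P‖ ≤ 1 :=
  z_norm_le P h.1 1 zero_le_one fun f _ => by rw [h.2, one_mul]

lemma ZGood.one : ZGood (1 : Lp ℝ 1 μ →L[ℝ] Lp ℝ 1 μ) := ⟨fun _ h => h, fun _ => rfl⟩

lemma ZGood.mul {P Q : Lp ℝ 1 μ →L[ℝ] Lp ℝ 1 μ} (hP : ZGood P) (hQ : ZGood Q) : ZGood (P * Q) :=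
  ⟨fun f h => hP.1 _ (hQ.1 f h), fun f => (hP.2 _).trans (hQ.2 f)⟩

lemma ZGood.pow {P : Lp ℝ 1 μ →L[ℝ] Lp ℝ 1 μ} (hP : ZGood P) (n : ℕ) : ZGood (P ^ n) := by
  induction n with
  | zero => simpa using ZGood.one
  | succ n ih => rw [pow_succ]; exact ih.mul hP

lemma z_list (l : List (Lp ℝ 1 μ →L[ℝ] Lp ℝ 1 μ)) (h : ∀ x ∈ l, ZGood x) : ZGood l.prod := by
  induction l with
  | nil => simpa using ZGood.one
  | cons a l ih =>
    rw [List.prod_cons]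
    exact (h a (by simp)).mul (ih fun x hx => h x (by simp [hx]))

lemma z_multi {d : ℕ} (T : Fin d → (Lp ℝ 1 μ →L[ℝ] Lp ℝ 1 μ)) (h : ∀ i, ZGood (T i))
    (n : Fin d → ℕ) : ZGood (multiPow T n) := by
  refine z_list _ fun x hx => ?_
  rw [List.mem_ofFn] at hx
  obtain ⟨i, rfl⟩ := hx
  exact (h i).pow _

lemma z_decomp (V E S R : Lp ℝ 1 μ →L[ℝ] Lp ℝ 1 μ) (hc : Commute V E) (hV : V = E * S + R)
    (pV : ∀ f, 0 ≤ f → 0 ≤ V f) (pS : ∀ f, 0 ≤ f → 0 ≤ S f) (pR : ∀ f, 0 ≤ f → 0 ≤ R f) (n : ℕ) :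
    (∀ f, 0 ≤ f → 0 ≤ (R ^ n) f) ∧
    ∃ Q : Lp ℝ 1 μ →L[ℝ] Lp ℝ 1 μ, (∀ f, 0 ≤ f → 0 ≤ Q f) ∧ V ^ n = E * Q + R ^ n := by
  induction n with
  | zero => exact ⟨fun f h => by simpa using h, 0, fun f _ => by simp, by simp⟩
  | succ n ih =>
    obtain ⟨h1, Q, hQ, e⟩ := ih
    refine ⟨fun f h => ?_, V * Q + S * R ^ n, fun f h => ?_, ?_⟩
    · rw [pow_succ']; exact pR _ (h1 f h)
    · exact add_nonneg (pV _ (hQ f h)) (pS _ (h1 f h))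
    · rw [pow_succ', e, mul_add, ← mul_assoc V E, hc.eq, pow_succ' R]
      have : R = V - E * S := by rw [hV]; abel
      nth_rw 3 [this]
      noncomm_ring

end Op

theorem stmt8 {X : Type*} [MeasurableSpace X] (μ : Measure X) (d : ℕ)
    (T : Fin d → (Lp ℝ 1 μ →L[ℝ] Lp ℝ 1 μ))
    (hpos : ∀ i, ∀ f : Lp ℝ 1 μ, 0 ≤ f → 0 ≤ (T i) f)
    (hnorm : ∀ i, ‖T i‖ ≤ 1)
    (hunital : ∀ i, ∀ f : Lp ℝ 1 μ, L1.integral ((T i) f) = L1.integral f)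
    (hcomm : ∀ i j, (T i) * (T j) = (T j) * (T i))
    (m k : Fin d → ℕ)
    (S : Lp ℝ 1 μ →L[ℝ] Lp ℝ 1 μ)
    (hSpos : ∀ f : Lp ℝ 1 μ, 0 ≤ f → 0 ≤ S f) (hSnorm : ‖S‖ ≤ 1)
    (h1 : ∀ f : Lp ℝ 1 μ, 0 ≤ f → S f ≤ (multiPow T (m + k)) f)
    (h2 : ∀ f : Lp ℝ 1 μ, 0 ≤ f → S f ≤ (multiPow T m) f)
    (h3 : ‖multiPow T (m + k) - S‖ < 1) (h4 : ‖multiPow T m - S‖ < 1) :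
    Tendsto (fun n : Fin d → ℕ => ‖multiPow T (n + k) - multiPow T n‖)
      atTop (nhds 0) := by
  have hT : ∀ i, ZGood (T i) := fun i => ⟨hpos i, hunital i⟩
  have hadd : ∀ a b, multiPow T (a + b) = multiPow T a * multiPow T b :=
    fun a b => z_ofFn_mul T hcomm a b
  have hcm : ∀ a b, Commute (multiPow T a) (multiPow T b) := fun a b => by
    rw [Commute, SemiconjBy, ← hadd, ← hadd, add_comm]
  have hg := z_multi T hT
  have hpow : ∀ (a : Fin d → ℕ) (j : ℕ), multiPow T (j • a) = multiPow T a ^ j := by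
    intro a j
    induction j with
    | zero => simp [multiPow, List.ofFn_const]
    | succ j ih => rw [succ_nsmul, hadd, ih, pow_succ]
  set K := multiPow T k with hKdef
  set V := multiPow T (m + k) with hVdef
  have h1n : ‖(1 : Lp ℝ 1 μ →L[ℝ] Lp ℝ 1 μ)‖ ≤ 1 := ZGood.one.norm_le
  set E : Lp ℝ 1 μ →L[ℝ] Lp ℝ 1 μ := (1 / 2 : ℝ) • (1 + K) with hE
  have hEap : ∀ f, E f = (1 / 2 : ℝ) • (f + K f) := fun f => by simp [hE]
  have hsm : ∀ f : Lp ℝ 1 μ, 0 ≤ f → 0 ≤ (1 / 2 : ℝ) • f := fun f hf =>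
    z_smul f hf
  have gE : ZGood E := by
    refine ⟨fun f hf => ?_, fun f => ?_⟩
    · rw [hEap]; exact hsm _ (add_nonneg hf ((hg k).1 f hf))
    · rw [hEap, L1.integral_smul, L1.integral_add, (hg k).2, smul_eq_mul]; ring
  have hVE : Commute V E := by
    rw [hE]
    exact ((Commute.one_right V).add_right (hcm _ _)).smul_right _
  set R := V - E * S with hR
  have hV : V = E * S + R := by rw [hR]; abel
  have pR : ∀ f, 0 ≤ f → 0 ≤ R f := by
    intro f hf
    have a1 := h1 f hf
    have a2 : K (S f) ≤ V f := by
      have := (hg k).1 _ (sub_nonneg.2 (h2 f hf))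
      rw [map_sub, sub_nonneg] at this
      rw [hVdef, add_comm, hadd]
      exact this
    have : R f = (1 / 2 : ℝ) • ((V f - S f) + (V f - K (S f))) := by
      have : R f = V f - E (S f) := rfl
      rw [this, hEap]; module
    rw [this]
    exact hsm _ (add_nonneg (sub_nonneg.2 a1) (sub_nonneg.2 a2))
  set ρ := ‖V - S‖ with hρ
  have hRn : ‖R‖ ≤ ρ := by
    refine z_norm_le R pR ρ (norm_nonneg _) fun f hf => ?_
    have e1 : L1.integral (R f) = L1.integral ((V - S) f) := by
      have : R f = V f - E (S f) := rfl
      rw [this, _root_.sub_apply, L1.integral_sub, L1.integral_sub, gE.2]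
    have p : 0 ≤ (V - S) f := sub_nonneg.2 (h1 f hf)
    rw [e1, ← z_norm_eq _ p, ← z_norm_eq _ hf]
    exact (V - S).le_opNorm f
  -- quantitative bound
  have bound : ∀ n p : ℕ, ‖(1 - K) * V ^ (n * (2 * p))‖
      ≤ 2 * ((Nat.centralBinom p : ℝ) / 4 ^ p) + 2 * ((2 * p : ℕ) * ρ ^ n) := by
    intro n p
    obtain ⟨pRn, Q, pQ, eQ⟩ := z_decomp V E S R hVE hV (hg _).1 hSpos pR n
    have hQn : ‖Q‖ ≤ 1 := by
      refine z_norm_le Q pQ 1 zero_le_one fun f hf => ?_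
      have e1 : L1.integral f = L1.integral (Q f) + L1.integral ((R ^ n) f) := by
        have : (V ^ n) f = E (Q f) + (R ^ n) f := by rw [eQ]; rfl
        rw [← ((hg (m + k)).pow n).2 f, ← hVdef, this, L1.integral_add, gE.2]
      have := z_norm_eq _ (pRn f hf)
      have := norm_nonneg ((R ^ n) f)
      linarith
    have hr := z_rem h1n (V ^ n) E Q (R ^ n) (ρ ^ n) eQ (hVE.pow_left n) hQn
      ((hg _).pow n).norm_le gE.norm_le (z_norm_pow_le h1n R ρ hRn n) (2 * p)
    rw [← pow_mul] at hr
    have e : (1 - K) * V ^ (n * (2 * p)) = ((1 - K) * E ^ (2 * p)) * Q ^ (2 * p)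
        + (1 - K) * (V ^ (n * (2 * p)) - E ^ (2 * p) * Q ^ (2 * p)) := by
      rw [mul_sub, mul_assoc]; abel
    have hb := z_binom h1n K (hg k).norm_le p
    have hQp : ‖Q ^ (2 * p)‖ ≤ 1 := by simpa using z_norm_pow_le h1n Q 1 hQn (2 * p)
    have hK2 : ‖1 - K‖ ≤ 2 := by
      refine (norm_sub_le _ _).trans ?_
      linarith [(hg k).norm_le]
    rw [e]
    refine (norm_add_le _ _).trans (add_le_add ?_ ?_)
    · refine (norm_mul_le _ _).trans ?_
      exact (mul_le_of_le_one_right (norm_nonneg _) hQp).trans hb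
    · refine (norm_mul_le _ _).trans ?_
      exact mul_le_mul hK2 hr (norm_nonneg _) zero_le_two
  rw [Metric.tendsto_atTop]
  intro ε hε
  obtain ⟨p, hp⟩ := (z_cb_tendsto.eventually (gt_mem_nhds (half_pos hε))).exists
  have hlim : Tendsto (fun n : ℕ => 2 * (((2 * p : ℕ) : ℝ) * ρ ^ n)) atTop (nhds 0) := by
    have := ((tendsto_pow_atTop_nhds_zero_of_lt_one (norm_nonneg _) h3).const_mul
      ((2 * p : ℕ) : ℝ)).const_mul 2
    simpa using this
  obtain ⟨n, hn⟩ := (hlim.eventually (gt_mem_nhds (half_pos hε))).exists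
  refine ⟨(n * (2 * p)) • (m + k), fun N hN => ?_⟩
  obtain ⟨M, rfl⟩ := exists_add_of_le hN
  have e : multiPow T ((n * (2 * p)) • (m + k) + M + k) - multiPow T ((n * (2 * p)) • (m + k) + M)
      = -((1 - K) * V ^ (n * (2 * p)) * multiPow T M) := by
    rw [add_comm _ k, hadd, hadd, hpow]
    noncomm_ring
  rw [dist_zero_right, norm_norm, e, norm_neg]
  refine (norm_mul_le _ _).trans_lt ?_
  refine (mul_le_of_le_one_right (norm_nonneg _) (hg M).norm_le).trans_lt ?_
  linarith [bound n p]
end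

section
/- Let T be a positive contraction of L¹(μ). If there is m ∈ ℕ such that ‖T^{m+1} − (T^{m+1} ∧ T^m)‖ < 1, then lim_{n→∞} ‖T^{n+1} − Tⁿ‖ = 0. -/
open MeasureTheory Filter

/-- `C` is the lattice infimum `A ∧ B` in the ordered space of operators on `L¹`:
the greatest operator `≤ A` and `≤ B` for the positivity order. -/
def IsOpInf {X : Type*} [MeasurableSpace X] {μ : Measure X}
    (A B C : Lp ℝ 1 μ →L[ℝ] Lp ℝ 1 μ) : Prop :=
  (∀ f : Lp ℝ 1 μ, 0 ≤ f → C f ≤ A f) ∧ (∀ f : Lp ℝ 1 μ, 0 ≤ f → C f ≤ B f) ∧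
    ∀ D : Lp ℝ 1 μ →L[ℝ] Lp ℝ 1 μ,
      (∀ f : Lp ℝ 1 μ, 0 ≤ f → D f ≤ A f) → (∀ f : Lp ℝ 1 μ, 0 ≤ f → D f ≤ B f) →
        ∀ f : Lp ℝ 1 μ, 0 ≤ f → D f ≤ C f

lemma zt_norm_add {X : Type*} [MeasurableSpace X] {μ : Measure X} (f g : Lp ℝ 1 μ)
    (hf : 0 ≤ f) (hg : 0 ≤ g) : ‖f + g‖ = ‖f‖ + ‖g‖ := by
  rw [L1.norm_eq_integral_norm, L1.norm_eq_integral_norm, L1.norm_eq_integral_norm,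
    ← integral_add (L1.integrable_coeFn f).norm (L1.integrable_coeFn g).norm]
  apply integral_congr_ae
  have hf' := (Lp.coeFn_nonneg f).2 hf
  have hg' := (Lp.coeFn_nonneg g).2 hg
  filter_upwards [Lp.coeFn_add f g, hf', hg'] with x h1 h2 h3
  simp only [Pi.zero_apply] at h2 h3
  rw [h1, Pi.add_apply, Real.norm_of_nonneg h2, Real.norm_of_nonneg h3,
    Real.norm_of_nonneg (add_nonneg h2 h3)]

lemma zt_norm_mono {X : Type*} [MeasurableSpace X] {μ : Measure X} (f g : Lp ℝ 1 μ)
    (hf : 0 ≤ f) (hg : f ≤ g) : ‖f‖ ≤ ‖g‖ := by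
  have h := zt_norm_add f (g - f) hf (sub_nonneg.2 hg)
  rw [add_sub_cancel] at h
  rw [h]
  linarith [norm_nonneg (g - f)]

lemma zt_opNorm {X : Type*} [MeasurableSpace X] {μ : Measure X}
    (A : Lp ℝ 1 μ →L[ℝ] Lp ℝ 1 μ) (c : ℝ) (hc : 0 ≤ c)
    (hA : ∀ f : Lp ℝ 1 μ, 0 ≤ f → ‖A f‖ ≤ c * ‖f‖) : ‖A‖ ≤ c := by
  refine A.opNorm_le_bound hc fun f => ?_
  have h1 : ‖f‖ = ‖f⁺‖ + ‖f⁻‖ := by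
    rw [← zt_norm_add _ _ (posPart_nonneg f) (negPart_nonneg f), posPart_add_negPart,
      norm_abs_eq_norm]
  have h2 : A f = A f⁺ - A f⁻ := by rw [← map_sub, posPart_sub_negPart]
  rw [h2, h1, mul_add]
  exact (norm_sub_le _ _).trans (add_le_add (hA _ (posPart_nonneg f)) (hA _ (negPart_nonneg f)))

lemma zt_binom {A : Type*} [NormedRing A] [NormedAlgebra ℝ A] (T : A) (j : ℕ) :
    ((j : ℝ) + 1) • ((1 - T) * (1 + T) ^ j) =
      ∑ i ∈ Finset.range (j + 2), (((j + 1).choose i : ℝ) * ((j : ℝ) + 1 - 2 * i)) • T ^ i := by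
  have hb : ∀ n : ℕ, (1 + T) ^ n = ∑ i ∈ Finset.range (n + 1), (n.choose i : ℝ) • T ^ i := by
    intro n
    rw [add_comm, (Commute.one_right T).add_pow]
    refine Finset.sum_congr rfl fun i _ => ?_
    rw [one_pow, mul_one, Nat.cast_smul_eq_nsmul ℝ, nsmul_eq_mul, Nat.cast_comm]
  have h1 : ∑ i ∈ Finset.range (j + 2), (((j + 1).choose i : ℝ) * i) • T ^ i
      = ((j : ℝ) + 1) • (T * (1 + T) ^ j) := by
    rw [Finset.sum_range_succ', hb j, Finset.mul_sum, Finset.smul_sum]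
    simp only [Nat.cast_zero, mul_zero, zero_smul, add_zero]
    refine Finset.sum_congr rfl fun i _ => ?_
    have := Nat.add_one_mul_choose_eq j i
    have h2 : ((j : ℝ) + 1) * (j.choose i : ℝ) = ((j + 1).choose (i + 1) : ℝ) * ((i + 1 : ℕ) : ℝ) := by
      exact_mod_cast this
    rw [← h2, mul_smul_comm, smul_smul, pow_succ']
  have h3 : ∀ i : ℕ, (((j + 1).choose i : ℝ) * ((j : ℝ) + 1 - 2 * i)) • T ^ i =
      ((j : ℝ) + 1) • (((j + 1).choose i : ℝ) • T ^ i)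
        - (2 : ℝ) • ((((j + 1).choose i : ℝ) * i) • T ^ i) := by
    intro i
    rw [smul_smul, smul_smul, ← sub_smul]
    congr 1
    ring
  simp only [h3]
  rw [Finset.sum_sub_distrib, ← Finset.smul_sum, ← Finset.smul_sum, h1, ← hb (j + 1), smul_smul,
    mul_comm (2 : ℝ), ← smul_smul, ← smul_sub]
  congr 1
  rw [pow_succ', two_smul]
  noncomm_ring

lemma zt_var (n : ℕ) :
    ∑ i ∈ Finset.range (n + 1), (n.choose i : ℝ) * ((n : ℝ) - 2 * i) ^ 2 = (n : ℝ) * (2 : ℝ) ^ n := by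
  have h := congrArg (Polynomial.eval (1 / 2 : ℝ)) (bernsteinPolynomial.variance ℝ n)
  rw [Polynomial.eval_finsetSum] at h
  simp only [bernsteinPolynomial, nsmul_eq_mul, Polynomial.eval_mul, Polynomial.eval_pow,
    Polynomial.eval_sub, Polynomial.eval_natCast, Polynomial.eval_X, Polynomial.eval_one] at h
  have h2 : ∀ i ∈ Finset.range (n + 1), (n.choose i : ℝ) * ((n : ℝ) - 2 * i) ^ 2 =
      4 * 2 ^ n * (((n : ℝ) * (1 / 2) - i) ^ 2 *
        ((n.choose i : ℝ) * (1 / 2) ^ i * (1 - 1 / 2) ^ (n - i))) := by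
    intro i hi
    have hi' : i ≤ n := by simpa [Nat.lt_succ_iff] using hi
    have h4 : (1 / 2 : ℝ) ^ i * (1 - 1 / 2) ^ (n - i) * 2 ^ n = 1 := by
      rw [show (1 - 1 / 2 : ℝ) = 1 / 2 by norm_num, ← pow_add, Nat.add_sub_cancel' hi',
        ← mul_pow]
      norm_num
    linear_combination (-(4 * ((n : ℝ) * (1 / 2) - i) ^ 2 * (n.choose i : ℝ))) * h4
  rw [Finset.sum_congr rfl h2, ← Finset.mul_sum, h]
  ring

lemma zt_bound {A : Type*} [NormedRing A] [NormOneClass A] [NormedAlgebra ℝ A] (T : A)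
    (hT : ‖T‖ ≤ 1) (j : ℕ) :
    ‖(1 - T) * ((1 / 2 : ℝ) • (1 + T)) ^ j‖ ≤ 2 / √((j : ℝ) + 1) := by
  have hj : (0 : ℝ) < (j : ℝ) + 1 := by positivity
  have hpow : ∀ i : ℕ, ‖T ^ i‖ ≤ 1 := fun i =>
    (norm_pow_le T i).trans (pow_le_one₀ (norm_nonneg _) hT)
  have h1 : ((j : ℝ) + 1) * ‖(1 - T) * (1 + T) ^ j‖ ≤
      ∑ i ∈ Finset.range (j + 2), ((j + 1).choose i : ℝ) * |(j : ℝ) + 1 - 2 * i| := by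
    have := congrArg norm (zt_binom T j)
    rw [norm_smul, Real.norm_of_nonneg hj.le] at this
    rw [this]
    refine (norm_sum_le _ _).trans (Finset.sum_le_sum fun i _ => ?_)
    rw [norm_smul, norm_mul, Real.norm_natCast, Real.norm_eq_abs]
    exact mul_le_of_le_one_right (by positivity) (hpow i)
  have hcs := Finset.sum_mul_sq_le_sq_mul_sq (Finset.range (j + 2))
    (fun i => √((j + 1).choose i : ℝ)) (fun i => √((j + 1).choose i : ℝ) * |(j : ℝ) + 1 - 2 * i|)
  have hs : ∀ i : ℕ, √((j + 1).choose i : ℝ) * √((j + 1).choose i : ℝ) = ((j + 1).choose i : ℝ) :=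
    fun i => Real.mul_self_sqrt (by positivity)
  simp only [← mul_assoc, hs, mul_pow, sq_abs, sq (√_)] at hcs
  have hv := zt_var (j + 1)
  push_cast at hv
  have hc : ∑ i ∈ Finset.range (j + 2), ((j + 1).choose i : ℝ) = 2 ^ (j + 1) := by
    exact_mod_cast Nat.sum_range_choose (j + 1)
  rw [hv, hc] at hcs
  have h2 : ∑ i ∈ Finset.range (j + 2), ((j + 1).choose i : ℝ) * |(j : ℝ) + 1 - 2 * i|
      ≤ √((j : ℝ) + 1) * 2 ^ (j + 1) := by
    refine (sq_le_sq₀ (Finset.sum_nonneg fun i _ => by positivity) (by positivity)).1 ?_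
    rw [mul_pow, Real.sq_sqrt hj.le]
    calc _ ≤ _ := hcs
      _ = _ := by ring
  have h3 : ‖(1 - T) * ((1 / 2 : ℝ) • (1 + T)) ^ j‖ = (1 / 2) ^ j * ‖(1 - T) * (1 + T) ^ j‖ := by
    rw [smul_pow, mul_smul_comm, norm_smul, norm_pow]
    norm_num
  have hsq : √((j : ℝ) + 1) * √((j : ℝ) + 1) = (j : ℝ) + 1 := Real.mul_self_sqrt hj.le
  have hsp : 0 < √((j : ℝ) + 1) := Real.sqrt_pos.2 hj
  rw [h3, le_div_iff₀ hsp]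
  have h4 : √((j : ℝ) + 1) * ‖(1 - T) * (1 + T) ^ j‖ ≤ 2 ^ (j + 1) := by
    refine le_of_mul_le_mul_left ?_ hsp
    rw [← mul_assoc, hsq]
    exact h1.trans h2
  calc _ = (1 / 2) ^ j * (√((j : ℝ) + 1) * ‖(1 - T) * (1 + T) ^ j‖) := by ring
    _ ≤ (1 / 2) ^ j * 2 ^ (j + 1) := by gcongr
    _ = 2 := by rw [pow_succ, ← mul_assoc, ← mul_pow]; norm_num

/-- If powers of `T` are, up to small error, `M * D` with `D` a contraction and
`M = (1 + T) / 2`, then `T ^ (n + 1) - T ^ n` tends to zero. -/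
lemma zt_main {A : Type*} [NormedRing A] [NormOneClass A] [NormedAlgebra ℝ A] (T : A)
    (hT : ‖T‖ ≤ 1)
    (H : ∀ ε : ℝ, 0 < ε → ∃ (p : ℕ) (D E : A),
      T ^ p = ((1 / 2 : ℝ) • (1 + T)) * D + E ∧ ‖D‖ ≤ 1 ∧ ‖E‖ ≤ ε) :
    Tendsto (fun n : ℕ => ‖T ^ (n + 1) - T ^ n‖) atTop (nhds 0) := by
  have hpow : ∀ i : ℕ, ‖T ^ i‖ ≤ 1 := fun i =>
    (norm_pow_le T i).trans (pow_le_one₀ (norm_nonneg _) hT)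
  set M := (1 / 2 : ℝ) • (1 + T) with hM
  have hMn : ‖M‖ ≤ 1 := by
    rw [hM, norm_smul]
    have : ‖1 + T‖ ≤ 1 + 1 := (norm_add_le _ _).trans (by rw [norm_one]; gcongr)
    norm_num
    linarith
  have hMT : Commute M T :=
    ((Commute.one_left T).add_left (Commute.refl T)).smul_left _
  have hanti : Antitone (fun n : ℕ => ‖T ^ (n + 1) - T ^ n‖) := by
    refine antitone_nat_of_succ_le fun n => ?_
    have : T ^ (n + 1 + 1) - T ^ (n + 1) = T * (T ^ (n + 1) - T ^ n) := by
      rw [mul_sub, ← pow_succ', ← pow_succ']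
    rw [this]
    exact (norm_mul_le _ _).trans (mul_le_of_le_one_left (norm_nonneg _) hT)
  have key : ∀ δ : ℝ, 0 < δ → ∃ n : ℕ, ‖T ^ (n + 1) - T ^ n‖ < δ := by
    intro δ hδ
    obtain ⟨j, hj⟩ : ∃ j : ℕ, 2 / √((j : ℝ) + 1) < δ / 2 := by
      obtain ⟨j, hj⟩ := exists_nat_gt ((4 / δ) ^ 2)
      refine ⟨j, ?_⟩
      have h1 : 4 / δ < √((j : ℝ) + 1) := Real.lt_sqrt_of_sq_lt (by linarith)
      have hp : 0 < √((j : ℝ) + 1) := lt_trans (by positivity) h1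
      rw [div_lt_iff₀ hδ] at h1
      rw [div_lt_iff₀ hp]
      linarith
    obtain ⟨p, D, E, hp, hD, hE⟩ := H (δ / (4 * (j + 1))) (by positivity)
    set ε := δ / (4 * ((j : ℝ) + 1)) with hε
    have hDp : ∀ i : ℕ, ‖D ^ i‖ ≤ 1 := fun i =>
      (norm_pow_le D i).trans (pow_le_one₀ (norm_nonneg _) hD)
    have hMp : ∀ i : ℕ, ‖M ^ i‖ ≤ 1 := fun i =>
      (norm_pow_le M i).trans (pow_le_one₀ (norm_nonneg _) hMn)
    have ind : ∀ i : ℕ, ‖T ^ (p * i) - M ^ i * D ^ i‖ ≤ i * ε := by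
      intro i
      induction i with
      | zero => simp
      | succ i ih =>
        have hc : T ^ p * M ^ i = M ^ i * T ^ p := ((hMT.pow_pow i p).eq).symm
        have e : T ^ (p * (i + 1)) - M ^ (i + 1) * D ^ (i + 1) =
            T ^ p * (T ^ (p * i) - M ^ i * D ^ i) + M ^ i * E * D ^ i := by
          have hE' : E = T ^ p - M * D := by rw [hp]; abel
          rw [mul_sub, ← mul_assoc, hc, hE', mul_sub, sub_mul, mul_add, mul_one, add_comm (p * i),
            pow_add, pow_succ M, pow_succ' D]
          simp only [mul_assoc]
          abel
        rw [e]
        refine (norm_add_le _ _).trans ?_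
        have h1 : ‖T ^ p * (T ^ (p * i) - M ^ i * D ^ i)‖ ≤ i * ε :=
          (norm_mul_le _ _).trans
            ((mul_le_of_le_one_left (norm_nonneg _) (hpow p)).trans ih)
        have h2 : ‖M ^ i * E * D ^ i‖ ≤ ε :=
          (norm_mul_le _ _).trans ((mul_le_of_le_one_right (norm_nonneg _) (hDp i)).trans
            ((norm_mul_le _ _).trans
              ((mul_le_of_le_one_left (norm_nonneg _) (hMp i)).trans hE)))
        push_cast
        linarith
    refine ⟨p * j, ?_⟩
    have e : T ^ (p * j + 1) - T ^ (p * j) =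
        -((1 - T) * M ^ j * D ^ j) - (1 - T) * (T ^ (p * j) - M ^ j * D ^ j) := by
      rw [pow_succ']
      noncomm_ring
    have hb := zt_bound T hT j
    rw [← hM] at hb
    have h1 : ‖(1 - T) * M ^ j * D ^ j‖ ≤ 2 / √((j : ℝ) + 1) :=
      (norm_mul_le _ _).trans ((mul_le_of_le_one_right (norm_nonneg _) (hDp j)).trans hb)
    have h1T : ‖1 - T‖ ≤ 2 := (norm_sub_le _ _).trans (by rw [norm_one]; linarith)
    have h2 : ‖(1 - T) * (T ^ (p * j) - M ^ j * D ^ j)‖ ≤ 2 * (j * ε) :=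
      (norm_mul_le _ _).trans (mul_le_mul h1T (ind j) (norm_nonneg _) (by norm_num))
    have h3 : 2 * (j * ε) ≤ δ / 2 := by
      have h5 : (((j : ℝ) + 1) * ε) = δ / 4 := by rw [hε]; field_simp
      have h6 : 0 < ε := by positivity
      nlinarith
    rw [e]
    refine (norm_sub_le _ _).trans_lt ?_
    rw [norm_neg]
    linarith
  rw [Metric.tendsto_atTop]
  intro δ hδ
  obtain ⟨N, hN⟩ := key δ hδ
  refine ⟨N, fun n hn => ?_⟩
  rw [Real.dist_0_eq_abs, abs_of_nonneg (norm_nonneg _)]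
  exact (hanti hn).trans_lt hN

theorem stmt10 {X : Type*} [MeasurableSpace X] (μ : Measure X)
    (T : Lp ℝ 1 μ →L[ℝ] Lp ℝ 1 μ)
    (hTpos : ∀ f : Lp ℝ 1 μ, 0 ≤ f → 0 ≤ T f) (hTnorm : ‖T‖ ≤ 1)
    (m : ℕ) (hm : 1 ≤ m) (C : Lp ℝ 1 μ →L[ℝ] Lp ℝ 1 μ)
    (hC : IsOpInf (T ^ (m + 1)) (T ^ m) C)
    (h : ‖T ^ (m + 1) - C‖ < 1) :
    Tendsto (fun n : ℕ => ‖T ^ (n + 1) - T ^ n‖) atTop (nhds 0) := by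
  rcases subsingleton_or_nontrivial (Lp ℝ 1 μ) with hs | hn
  · have : ∀ n : ℕ, ‖T ^ (n + 1) - T ^ n‖ = 0 := fun n => by
      rw [norm_eq_zero]
      ext1 f
      exact Subsingleton.elim _ _
    simp [this]
  obtain ⟨hC1, hC2, hC3⟩ := hC
  have hTp : ∀ n : ℕ, ∀ f : Lp ℝ 1 μ, 0 ≤ f → 0 ≤ (T ^ n) f := by
    intro n
    induction n with
    | zero => intro f hf; simpa using hf
    | succ n ih =>
      intro f hf
      rw [pow_succ']
      exact hTpos _ (ih f hf)
  have hpow : ∀ i : ℕ, ‖T ^ i‖ ≤ 1 := fun i =>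
    (norm_pow_le T i).trans (pow_le_one₀ (norm_nonneg _) hTnorm)
  have hC0 : ∀ f : Lp ℝ 1 μ, 0 ≤ f → 0 ≤ C f := fun f hf => by
    simpa using hC3 0 (fun f hf => by simpa using hTp (m + 1) f hf)
      (fun f hf => by simpa using hTp m f hf) f hf
  have hhalf : ∀ f : Lp ℝ 1 μ, 0 ≤ f → 0 ≤ (1 / 2 : ℝ) • f := fun f hf => by
    rw [← Lp.coeFn_nonneg] at hf ⊢
    filter_upwards [Lp.coeFn_smul (1 / 2 : ℝ) f, hf] with x h1 h2
    rw [h1, Pi.smul_apply, smul_eq_mul]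
    simp only [Pi.zero_apply] at h2 ⊢
    positivity
  have hP : ‖T ^ m - C‖ ≤ 1 := by
    refine zt_opNorm _ 1 zero_le_one fun f hf => ?_
    have h1 : ‖(T ^ m - C) f‖ ≤ ‖(T ^ m) f‖ := by
      refine zt_norm_mono _ _ (sub_nonneg.2 (hC2 f hf)) ?_
      exact sub_le_self _ (hC0 f hf)
    exact h1.trans ((T ^ m).le_of_opNorm_le (hpow m) f)
  set M := (1 / 2 : ℝ) • (1 + T) with hM
  set R := (1 / 2 : ℝ) • (T ^ (m + 1) - C) + (1 / 2 : ℝ) • (T * (T ^ m - C)) with hR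
  have hMT : Commute M T :=
    ((Commute.one_left T).add_left (Commute.refl T)).smul_left _
  have hR0 : ∀ f : Lp ℝ 1 μ, 0 ≤ f → 0 ≤ R f := fun f hf =>
    add_nonneg (hhalf _ (sub_nonneg.2 (hC1 f hf)))
      (hhalf _ (hTpos _ (sub_nonneg.2 (hC2 f hf))))
  have hRp : ∀ n : ℕ, ∀ f : Lp ℝ 1 μ, 0 ≤ f → 0 ≤ (R ^ n) f := by
    intro n
    induction n with
    | zero => intro f hf; simpa using hf
    | succ n ih =>
      intro f hf
      rw [pow_succ']
      exact hR0 _ (ih f hf)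
  have hRn : ‖R‖ < 1 := by
    have h2 : ‖T * (T ^ m - C)‖ ≤ 1 :=
      (norm_mul_le _ _).trans (mul_le_one₀ hTnorm (norm_nonneg _) hP)
    have h3 := norm_add_le ((1 / 2 : ℝ) • (T ^ (m + 1) - C)) ((1 / 2 : ℝ) • (T * (T ^ m - C)))
    rw [norm_smul, norm_smul, Real.norm_of_nonneg (by norm_num : (0 : ℝ) ≤ 1 / 2)] at h3
    linarith
  have hdec : T ^ (m + 1) = M * C + R := by
    have h1 : T * (T ^ m - C) = T ^ (m + 1) - T * C := by rw [mul_sub, ← pow_succ']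
    rw [hR, hM, h1, smul_mul_assoc, add_mul, one_mul]
    module
  clear_value R
  have hn : ∀ n : ℕ, ∃ Cn : Lp ℝ 1 μ →L[ℝ] Lp ℝ 1 μ, (∀ f, 0 ≤ f → 0 ≤ Cn f) ∧
      T ^ ((m + 1) * n) = M * Cn + R ^ n := by
    intro n
    induction n with
    | zero => exact ⟨0, fun f _ => le_refl _, by simp⟩
    | succ n ih =>
      obtain ⟨Cn, hp, he⟩ := ih
      refine ⟨T ^ ((m + 1) * n) * C + Cn * R, fun f hf =>
        add_nonneg (hTp _ _ (hC0 f hf)) (hp _ (hR0 f hf)), ?_⟩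
      have hc : T ^ ((m + 1) * n) * M = M * T ^ ((m + 1) * n) := ((hMT.pow_right _).eq).symm
      calc T ^ ((m + 1) * (n + 1)) = T ^ ((m + 1) * n) * T ^ (m + 1) := by
            rw [← pow_add, mul_add, mul_one]
        _ = T ^ ((m + 1) * n) * (M * C) + T ^ ((m + 1) * n) * R := by
            rw [← mul_add, ← hdec]
        _ = M * (T ^ ((m + 1) * n) * C) + (M * Cn + R ^ n) * R := by
            rw [← mul_assoc, hc, mul_assoc, ← he]
        _ = _ := by rw [add_mul (M * Cn), mul_add M, pow_succ R, mul_assoc M Cn R, add_assoc]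
  refine zt_main T hTnorm fun ε hε => ?_
  obtain ⟨n, hnε⟩ := exists_pow_lt_of_lt_one hε hRn
  obtain ⟨Cn, hp, he⟩ := hn n
  refine ⟨(m + 1) * n + 1, T * Cn, T * R ^ n, ?_, ?_, ?_⟩
  · rw [pow_succ', he, mul_add, ← mul_assoc, ← mul_assoc, hMT.eq]
  · refine zt_opNorm _ 1 zero_le_one fun f hf => ?_
    have h1 : ‖(M * Cn) f‖ ≤ ‖f‖ := by
      have h2 : (T ^ ((m + 1) * n)) f = (M * Cn) f + (R ^ n) f := by rw [he]; rfl
      have h3 : 0 ≤ (M * Cn) f :=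
        hhalf _ (add_nonneg (hp f hf) (hTpos _ (hp f hf)))
      have h4 : ‖(M * Cn) f‖ ≤ ‖(T ^ ((m + 1) * n)) f‖ := by
        refine zt_norm_mono _ _ h3 ?_
        rw [h2]
        exact le_add_of_nonneg_right (hRp n f hf)
      exact h4.trans (((T ^ ((m + 1) * n)).le_of_opNorm_le (hpow _) f).trans (one_mul _).le)
    have h5 : (M * Cn) f = (1 / 2 : ℝ) • (Cn f + T (Cn f)) := rfl
    rw [h5, norm_smul, zt_norm_add _ _ (hp f hf) (hTpos _ (hp f hf)),
      Real.norm_of_nonneg (by norm_num : (0 : ℝ) ≤ 1 / 2)] at h1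
    have h6 : ‖T (Cn f)‖ ≤ 1 * ‖Cn f‖ := T.le_of_opNorm_le hTnorm _
    change ‖T (Cn f)‖ ≤ 1 * ‖f‖
    linarith
  · exact (norm_mul_le _ _).trans ((mul_le_of_le_one_left (norm_nonneg _) hTnorm).trans
      ((norm_pow_le _ _).trans hnε.le))
end

section
/- Let T and S be two commuting unital positive contractions of L¹(μ), and k, m₀ ∈ ℕ. Suppose there is a positive contraction R on L¹(μ) such that T^{m₀+k}S^{m₀} ≥ R, T^{m₀}S^{m₀} ≥ R, ‖T^{m₀+k}S^{m₀} − R‖ < 1, and ‖T^{m₀}S^{m₀} − R‖ < 1. Then lim_{n,m→∞} ‖T^{n+k}S^m − TⁿS^m‖ = 0. -/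
open MeasureTheory Filter

namespace ZeroTwo

section alg
variable {L : Type*} [NormedRing L] [NormedAlgebra ℝ L]

lemma norm_mul_le_one {a b : L} (ha : ‖a‖ ≤ 1) (hb : ‖b‖ ≤ 1) : ‖a * b‖ ≤ 1 :=
  (norm_mul_le a b).trans (mul_le_one₀ ha (norm_nonneg _) hb)

lemma norm_pow_le_one (h1 : ‖(1 : L)‖ ≤ 1) {a : L} (ha : ‖a‖ ≤ 1) (n : ℕ) : ‖a ^ n‖ ≤ 1 := by
  induction n with
  | zero => simpa using h1
  | succ n ih => rw [pow_succ]; exact norm_mul_le_one ih ha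

lemma poly_identity (n : ℕ) :
    ((n : Polynomial ℝ) + 1) * (1 + Polynomial.X) ^ n * (1 - Polynomial.X) =
    ∑ i ∈ Finset.range (n + 2),
      Polynomial.C (((n + 1).choose i : ℝ) * ((n : ℝ) + 1 - 2 * i)) * Polynomial.X ^ i := by
  have hP : (1 + Polynomial.X : Polynomial ℝ) ^ (n + 1) = ∑ i ∈ Finset.range (n + 2),
      Polynomial.C ((n + 1).choose i : ℝ) * Polynomial.X ^ i := by
    rw [add_comm, add_pow]
    refine Finset.sum_congr rfl fun i _ => ?_
    simp [mul_comm]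
  have hD := congrArg Polynomial.derivative hP
  have hD2 : Polynomial.X * Polynomial.derivative (∑ i ∈ Finset.range (n + 2),
      Polynomial.C ((n + 1).choose i : ℝ) * Polynomial.X ^ i) = ∑ i ∈ Finset.range (n + 2),
      Polynomial.C (((n + 1).choose i : ℝ) * i) * Polynomial.X ^ i := by
    rw [Polynomial.derivative_sum, Finset.mul_sum]
    refine Finset.sum_congr rfl fun i _ => ?_
    rw [Polynomial.derivative_C_mul_X_pow]
    rcases i with _ | i
    · simp
    · simp only [Nat.add_sub_cancel]; ring
  have hs : ∑ i ∈ Finset.range (n + 2),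
      Polynomial.C (((n + 1).choose i : ℝ) * ((n : ℝ) + 1 - 2 * i)) * Polynomial.X ^ i
      = ((n : Polynomial ℝ) + 1) * (∑ i ∈ Finset.range (n + 2),
      Polynomial.C ((n + 1).choose i : ℝ) * Polynomial.X ^ i) -
      2 * ∑ i ∈ Finset.range (n + 2),
      Polynomial.C (((n + 1).choose i : ℝ) * i) * Polynomial.X ^ i := by
    rw [Finset.mul_sum, Finset.mul_sum, ← Finset.sum_sub_distrib]
    refine Finset.sum_congr rfl fun i _ => ?_
    simp only [map_mul, map_sub, map_add, map_natCast, map_one, map_ofNat]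
    ring
  rw [hs, ← hD2, ← hP]
  have : Polynomial.derivative ((1 + Polynomial.X : Polynomial ℝ) ^ (n + 1)) =
      ((n : Polynomial ℝ) + 1) * (1 + Polynomial.X) ^ n := by
    rw [Polynomial.derivative_pow]; simp
  rw [this, pow_succ]; ring

lemma variance_sum (N : ℕ) :
    ∑ i ∈ Finset.range (N + 1), (N.choose i : ℝ) * ((N : ℝ) - 2 * i) ^ 2 = (N : ℝ) * 2 ^ N := by
  have h := congrArg (Polynomial.eval (1/2 : ℝ)) (bernsteinPolynomial.variance ℝ N)
  rw [Polynomial.eval_finsetSum] at h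
  simp [bernsteinPolynomial] at h
  have h2 : ∀ i ∈ Finset.range (N + 1), (N.choose i : ℝ) * ((N : ℝ) - 2 * i) ^ 2 =
     (4 * 2 ^ N) * (((N : ℝ) * 2⁻¹ - i) ^ 2 * ((N.choose i : ℝ) * (2 ^ i)⁻¹ * (1 - 2⁻¹) ^ (N - i))) := by
    intro i hi
    have hi' : i ≤ N := by simpa [Nat.lt_succ_iff] using hi
    have e : (2 : ℝ) ^ N = 2 ^ i * 2 ^ (N - i) := by rw [← pow_add]; congr 1; omega
    have e2 : (1 - 2⁻¹ : ℝ) ^ (N - i) = (2 ^ (N - i))⁻¹ := by rw [← inv_pow]; norm_num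
    rw [e, e2]; field_simp; ring
  rw [Finset.sum_congr rfl h2, ← Finset.mul_sum, h]; ring

lemma abs_sum (N : ℕ) (c : ℝ) (hc : 0 < c) (hcN : c ^ 2 = N) :
    ∑ i ∈ Finset.range (N + 1), |(N.choose i : ℝ) * ((N : ℝ) - 2 * i)| ≤ c * 2 ^ N := by
  have h : ∀ i ∈ Finset.range (N + 1), |(N.choose i : ℝ) * ((N : ℝ) - 2 * i)| ≤
      (2 * c)⁻¹ * ((N.choose i : ℝ) * ((N : ℝ) - 2 * i) ^ 2) + (c / 2) * (N.choose i : ℝ) := by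
    intro i _
    rw [abs_mul, Nat.abs_cast]
    have : |(N : ℝ) - 2 * i| ≤ (2 * c)⁻¹ * ((N : ℝ) - 2 * i) ^ 2 + c / 2 := by
      rw [← sq_abs]
      generalize |(N : ℝ) - 2 * i| = t
      have : (2 * c)⁻¹ * t ^ 2 + c / 2 - t = (2 * c)⁻¹ * (t - c) ^ 2 := by field_simp; ring
      have h0 : 0 ≤ (2 * c)⁻¹ * (t - c) ^ 2 := by positivity
      linarith
    calc _ ≤ (N.choose i : ℝ) * ((2 * c)⁻¹ * ((N : ℝ) - 2 * i) ^ 2 + c / 2) := by gcongr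
      _ = _ := by ring
  refine (Finset.sum_le_sum h).trans (le_of_eq ?_)
  rw [Finset.sum_add_distrib, ← Finset.mul_sum, ← Finset.mul_sum, variance_sum]
  have := Nat.sum_range_choose N
  have h3 : ∑ i ∈ Finset.range (N + 1), (N.choose i : ℝ) = 2 ^ N := by exact_mod_cast this
  rw [h3, ← hcN]; field_simp; ring

lemma half_pow (h1 : ‖(1 : L)‖ ≤ 1) {V : L} (hV : ‖V‖ ≤ 1) (n : ℕ) :
    ‖((1/2 : ℝ) • (1 + V)) ^ n * (1 - V)‖ ≤ 2 / Real.sqrt (n + 1) := by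
  have h := congrArg (Polynomial.aeval V) (poly_identity n)
  simp only [map_mul, map_sum, map_add, map_sub, map_pow, map_one, Polynomial.aeval_X,
    Polynomial.aeval_C, map_natCast] at h
  have hpos : (0 : ℝ) < n + 1 := by positivity
  have hsq : Real.sqrt (n + 1) ^ 2 = ((n + 1 : ℕ) : ℝ) := by
    rw [Real.sq_sqrt hpos.le]; push_cast; rfl
  have hsp : 0 < Real.sqrt (n + 1) := Real.sqrt_pos.2 hpos
  have ha := abs_sum (n + 1) (Real.sqrt (n + 1)) hsp hsq
  have hb : ‖((n : L) + 1) * (1 + V) ^ n * (1 - V)‖ ≤ Real.sqrt (n + 1) * 2 ^ (n + 1) := by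
    rw [h]
    refine (norm_sum_le _ _).trans (le_trans (Finset.sum_le_sum fun i _ => ?_) ha)
    have hvi := norm_pow_le_one h1 hV i
    simp only [← map_natCast (algebraMap ℝ L), ← map_one (algebraMap ℝ L), ← map_add, ← map_mul,
      ← map_sub]
    rw [← Algebra.smul_def]
    refine (norm_smul_le _ _).trans ?_
    rw [Real.norm_eq_abs]
    push_cast
    exact mul_le_of_le_one_right (abs_nonneg _) hvi
  have hc : ((1/2 : ℝ) • (1 + V)) ^ n * (1 - V) =
      ((1/2 : ℝ) ^ n * (n + 1 : ℝ)⁻¹) • (((n : L) + 1) * (1 + V) ^ n * (1 - V)) := by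
    have e : ((n : L) + 1) = algebraMap ℝ L (n + 1) := by simp
    rw [e, mul_assoc, ← Algebra.smul_def, smul_smul, smul_pow, smul_mul_assoc]
    congr 1; field_simp
  rw [hc]
  refine (norm_smul_le _ _).trans ?_
  rw [Real.norm_of_nonneg (by positivity)]
  refine (mul_le_mul_of_nonneg_left hb (by positivity)).trans (le_of_eq ?_)
  have h5 : (n + 1 : ℝ) = Real.sqrt (n + 1) * Real.sqrt (n + 1) := (Real.mul_self_sqrt hpos.le).symm
  rw [one_div, inv_pow, pow_succ]
  have : (n + 1 : ℝ)⁻¹ = (Real.sqrt (n + 1))⁻¹ * (Real.sqrt (n + 1))⁻¹ := by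
    rw [← mul_inv, ← h5]
  rw [this]; field_simp

lemma norm_half_le (x : L) : ‖(1/2 : ℝ) • x‖ ≤ 1/2 * ‖x‖ := by
  refine (norm_smul_le _ _).trans (le_of_eq ?_)
  rw [Real.norm_of_nonneg (by norm_num)]

lemma iter (h1 : ‖(1 : L)‖ ≤ 1) {A U : L} (hA : ‖A‖ ≤ 1) (hU : ‖U‖ ≤ 1) (hAU : Commute A U)
    (h : ∀ ε > 0, ∃ (a : ℕ) (Q E : L), A ^ a = U * Q + E ∧ ‖Q‖ ≤ 1 ∧ ‖E‖ ≤ ε) (j : ℕ) :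
    ∀ ε > 0, ∃ (a : ℕ) (Q E : L), A ^ a = U ^ j * Q + E ∧ ‖Q‖ ≤ 1 ∧ ‖E‖ ≤ ε := by
  induction j with
  | zero => intro ε hε; exact ⟨0, 1, 0, by simp, h1, by simpa using hε.le⟩
  | succ j ih =>
    intro ε hε
    obtain ⟨a, Q, E, e, hQ, hE⟩ := ih (ε / 2) (by positivity)
    obtain ⟨b, Q', E', e', hQ', hE'⟩ := h (ε / 2) (by positivity)
    refine ⟨a + b, Q * Q', U * E * Q' + A ^ a * E', ?_, norm_mul_le_one hQ hQ', ?_⟩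
    · have hc : A ^ a * U = U * A ^ a := (hAU.pow_left a).eq
      rw [pow_add, e', mul_add, ← mul_assoc, hc]
      nth_rw 1 [e]
      rw [pow_succ']
      noncomm_ring
    · have x1 : ‖U * E * Q'‖ ≤ ε / 2 := by
        calc _ ≤ ‖U‖ * ‖E‖ * ‖Q'‖ := (norm_mul_le _ _).trans
              (mul_le_mul_of_nonneg_right (norm_mul_le _ _) (norm_nonneg _))
          _ ≤ 1 * (ε / 2) * 1 := by gcongr
          _ = _ := by ring
      have x2 : ‖A ^ a * E'‖ ≤ ε / 2 := by
        calc _ ≤ ‖A ^ a‖ * ‖E'‖ := norm_mul_le _ _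
          _ ≤ 1 * (ε / 2) := by gcongr; exact norm_pow_le_one h1 hA a
          _ = _ := by ring
      linarith [norm_add_le (U * E * Q') (A ^ a * E')]

end alg

section L1
variable {X : Type*} [MeasurableSpace X] {μ : Measure X}

lemma norm_eq_integral {f : Lp ℝ 1 μ} (hf : 0 ≤ f) : ‖f‖ = L1.integral f := by
  rw [L1.integral_eq_integral, L1.norm_eq_integral_norm]
  refine integral_congr_ae ?_
  filter_upwards [(Lp.coeFn_nonneg f).2 hf] with x hx
  exact Real.norm_of_nonneg hx

lemma half_nonneg {f : Lp ℝ 1 μ} (hf : 0 ≤ f) : 0 ≤ (1/2 : ℝ) • f := by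
  rw [← Lp.coeFn_nonneg]
  filter_upwards [(Lp.coeFn_nonneg f).2 hf, Lp.coeFn_smul (1/2 : ℝ) f] with x hx h
  rw [h]
  exact mul_nonneg (by norm_num) hx

lemma opNorm_le_one {Q : Lp ℝ 1 μ →L[ℝ] Lp ℝ 1 μ}
    (h : ∀ f : Lp ℝ 1 μ, 0 ≤ f → ‖Q f‖ ≤ ‖f‖) : ‖Q‖ ≤ 1 := by
  refine Q.opNorm_le_bound zero_le_one fun f => ?_
  have e : Q f = Q f⁺ - Q f⁻ := by rw [← map_sub, posPart_sub_negPart]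
  have e2 : ‖f‖ = ‖f⁺‖ + ‖f⁻‖ := by
    rw [norm_eq_integral (posPart_nonneg f), norm_eq_integral (negPart_nonneg f),
      ← L1.integral_add, posPart_add_negPart, ← norm_eq_integral (abs_nonneg f), norm_abs_eq_norm]
  rw [one_mul, e, e2]
  exact (norm_sub_le _ _).trans (add_le_add (h _ (posPart_nonneg f)) (h _ (negPart_nonneg f)))

end L1

end ZeroTwo

open ZeroTwo in
theorem stmt15 {X : Type*} [MeasurableSpace X] (μ : Measure X)
    (T S : Lp ℝ 1 μ →L[ℝ] Lp ℝ 1 μ)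
    (hTpos : ∀ f : Lp ℝ 1 μ, 0 ≤ f → 0 ≤ T f) (hTnorm : ‖T‖ ≤ 1)
    (hTunital : ∀ f : Lp ℝ 1 μ, L1.integral (T f) = L1.integral f)
    (hSpos : ∀ f : Lp ℝ 1 μ, 0 ≤ f → 0 ≤ S f) (hSnorm : ‖S‖ ≤ 1)
    (hSunital : ∀ f : Lp ℝ 1 μ, L1.integral (S f) = L1.integral f)
    (hTS : T * S = S * T)
    (k m₀ : ℕ)
    (R : Lp ℝ 1 μ →L[ℝ] Lp ℝ 1 μ)
    (hRpos : ∀ f : Lp ℝ 1 μ, 0 ≤ f → 0 ≤ R f) (hRnorm : ‖R‖ ≤ 1)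
    (h1 : ∀ f : Lp ℝ 1 μ, 0 ≤ f → R f ≤ (T ^ (m₀ + k) * S ^ m₀) f)
    (h2 : ∀ f : Lp ℝ 1 μ, 0 ≤ f → R f ≤ (T ^ m₀ * S ^ m₀) f)
    (h3 : ‖T ^ (m₀ + k) * S ^ m₀ - R‖ < 1) (h4 : ‖T ^ m₀ * S ^ m₀ - R‖ < 1) :
    Tendsto (fun p : ℕ × ℕ => ‖T ^ (p.1 + k) * S ^ p.2 - T ^ p.1 * S ^ p.2‖)
      atTop (nhds 0) := by
  have hone : ‖(1 : Lp ℝ 1 μ →L[ℝ] Lp ℝ 1 μ)‖ ≤ 1 := ContinuousLinearMap.norm_id_le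
  have hpp : ∀ (Z : Lp ℝ 1 μ →L[ℝ] Lp ℝ 1 μ), (∀ f, 0 ≤ f → 0 ≤ Z f) →
      ∀ (n : ℕ) f, 0 ≤ f → 0 ≤ (Z ^ n) f := by
    intro Z hZ n
    induction n with
    | zero => intro f hf; simpa using hf
    | succ n ih => intro f hf; rw [pow_succ]; exact ih _ (hZ _ hf)
  have hpi : ∀ (Z : Lp ℝ 1 μ →L[ℝ] Lp ℝ 1 μ), (∀ f, L1.integral (Z f) = L1.integral f) →
      ∀ (n : ℕ) f, L1.integral ((Z ^ n) f) = L1.integral f := by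
    intro Z hZ n
    induction n with
    | zero => intro f; simp
    | succ n ih => intro f; rw [pow_succ]; exact (ih _).trans (hZ _)
  have hcTS : Commute T S := hTS
  obtain ⟨V, hVdef⟩ : ∃ V, V = T ^ k := ⟨_, rfl⟩
  obtain ⟨A, hAdef⟩ : ∃ A, A = T ^ (m₀ + k) * S ^ m₀ := ⟨_, rfl⟩
  obtain ⟨B, hBdef⟩ : ∃ B, B = T ^ m₀ * S ^ m₀ := ⟨_, rfl⟩
  obtain ⟨U, hUdef⟩ : ∃ U, U = (1/2 : ℝ) • (1 + V) := ⟨_, rfl⟩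
  rw [← hAdef] at h3 h1
  rw [← hBdef] at h4 h2
  have hAB : A = V * B := by rw [hAdef, hBdef, hVdef, ← mul_assoc, ← pow_add, add_comm]
  have hVpos : ∀ f, 0 ≤ f → 0 ≤ V f := by rw [hVdef]; exact hpp T hTpos k
  have hApos : ∀ f, 0 ≤ f → 0 ≤ A f := fun f hf => (hRpos f hf).trans (h1 f hf)
  have hVn : ‖V‖ ≤ 1 := by rw [hVdef]; exact norm_pow_le_one hone hTnorm k
  have hAn : ‖A‖ ≤ 1 := by
    rw [hAdef]
    exact norm_mul_le_one (norm_pow_le_one hone hTnorm _) (norm_pow_le_one hone hSnorm _)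
  have hUn : ‖U‖ ≤ 1 := by
    rw [hUdef]
    refine (norm_half_le (1 + V)).trans ?_
    have := norm_add_le 1 V
    linarith
  have hAi : ∀ f, L1.integral (A f) = L1.integral f := by
    intro f; rw [hAdef]
    exact (hpi T hTunital _ _).trans (hpi S hSunital _ _)
  have hVi : ∀ f, L1.integral (V f) = L1.integral f := by rw [hVdef]; exact hpi T hTunital k
  have hUi : ∀ f, L1.integral (U f) = L1.integral f := by
    intro f; rw [hUdef]
    change L1.integral ((1/2 : ℝ) • (f + V f)) = _
    rw [L1.integral_smul, L1.integral_add, hVi, smul_eq_mul]; ring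
  have hAV : Commute A V := by
    rw [hAdef, hVdef]
    exact ((Commute.refl T).pow_pow _ _).mul_left ((hcTS.symm).pow_pow _ _)
  have hAU : Commute A U := by
    rw [hUdef]; exact ((Commute.one_right A).add_right hAV).smul_right _
  obtain ⟨D, hDdef⟩ : ∃ D, D = (1/2 : ℝ) • ((A - R) + V * (B - R)) := ⟨_, rfl⟩
  have hAD : A = U * R + D := by
    have : U * R + D = (1/2 : ℝ) • (A + V * B) := by
      rw [hUdef, hDdef, smul_mul_assoc, ← smul_add]; congr 1; noncomm_ring
    rw [this, ← hAB, ← two_smul ℝ A, smul_smul]; norm_num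
  have hDpos : ∀ f, 0 ≤ f → 0 ≤ D f := by
    intro f hf
    rw [hDdef]
    change 0 ≤ (1/2 : ℝ) • ((A f - R f) + V (B f - R f))
    have x1 : 0 ≤ A f - R f := sub_nonneg.2 (h1 f hf)
    have x2 : 0 ≤ V (B f - R f) := hVpos _ (sub_nonneg.2 (h2 f hf))
    exact half_nonneg (add_nonneg x1 x2)
  have hDn : ‖D‖ < 1 := by
    rw [hDdef]
    refine (norm_half_le (A - R + V * (B - R))).trans_lt ?_
    have x1 := norm_add_le (A - R) (V * (B - R))
    have x2 : ‖V * (B - R)‖ ≤ ‖B - R‖ :=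
      (norm_mul_le _ _).trans (mul_le_of_le_one_left (norm_nonneg _) hVn)
    linarith
  have hQ : ∀ n : ℕ, ∃ Q : Lp ℝ 1 μ →L[ℝ] Lp ℝ 1 μ, A ^ n = U * Q + D ^ n ∧
      ∀ f, 0 ≤ f → 0 ≤ Q f := by
    intro n
    induction n with
    | zero => exact ⟨0, by simp, by simp⟩
    | succ n ih =>
      obtain ⟨Q, e, hQ⟩ := ih
      refine ⟨A * Q + R * D ^ n, ?_, fun f hf => ?_⟩
      · rw [pow_succ', e, mul_add, ← mul_assoc, hAU.eq, pow_succ']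
        nth_rw 2 [hAD]
        noncomm_ring
      · exact add_nonneg (hApos _ (hQ f hf)) (hRpos _ (hpp D hDpos n f hf))
  have hstep : ∀ ε > 0, ∃ (a : ℕ) (Q E : Lp ℝ 1 μ →L[ℝ] Lp ℝ 1 μ),
      A ^ a = U * Q + E ∧ ‖Q‖ ≤ 1 ∧ ‖E‖ ≤ ε := by
    intro ε hε
    obtain ⟨a, ha⟩ := ((tendsto_pow_atTop_nhds_zero_of_norm_lt_one hDn).norm.eventually
      (ge_mem_nhds (by simpa using hε))).exists
    obtain ⟨Q, e, hQp⟩ := hQ a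
    refine ⟨a, Q, D ^ a, e, opNorm_le_one fun f hf => ?_, ha⟩
    rw [norm_eq_integral (hQp f hf), norm_eq_integral hf, ← hUi (Q f), ← hpi A hAi a f, e]
    change _ ≤ L1.integral (U (Q f) + (D ^ a) f)
    rw [L1.integral_add, ← norm_eq_integral (hpp D hDpos a f hf)]
    linarith [norm_nonneg ((D ^ a) f)]
  have hfin := iter hone hAn hUn hAU hstep
  rw [Metric.tendsto_nhds]
  intro ε hε
  obtain ⟨j, hj⟩ : ∃ j : ℕ, 2 / Real.sqrt (j + 1) < ε / 2 := by
    obtain ⟨j, hj⟩ := exists_nat_gt ((4 / ε) ^ 2)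
    refine ⟨j, ?_⟩
    have : 4 / ε < Real.sqrt (j + 1) := Real.lt_sqrt_of_sq_lt (by linarith)
    have hs : 0 < Real.sqrt (j + 1 : ℝ) := lt_trans (by positivity) this
    rw [div_lt_iff₀ hε] at this
    rw [div_lt_iff₀ hs]; linarith
  obtain ⟨a, Q, E, e, hQn, hE⟩ := hfin j (ε / 4) (by positivity)
  have hVU : Commute (1 - V) U := by
    rw [hUdef]
    refine Commute.smul_right (Commute.sub_left (Commute.one_left _) ?_) _
    exact (Commute.one_right V).add_right (Commute.refl V)
  have hkey : ‖(1 - V) * A ^ a‖ < ε := by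
    have e1 : (1 - V) * A ^ a = U ^ j * (1 - V) * Q + (1 - V) * E := by
      rw [e, mul_add, ← mul_assoc, (hVU.pow_right j).eq]
    have y1 : ‖U ^ j * (1 - V) * Q‖ ≤ 2 / Real.sqrt (j + 1) := by
      refine (norm_mul_le _ _).trans ((mul_le_of_le_one_right (norm_nonneg _) hQn).trans ?_)
      rw [hUdef]; exact half_pow hone hVn j
    have y2 : ‖(1 - V) * E‖ ≤ 2 * (ε / 4) := by
      refine (norm_mul_le _ _).trans ?_
      have := norm_sub_le 1 V
      gcongr
      linarith
    rw [e1]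
    linarith [norm_add_le (U ^ j * (1 - V) * Q) ((1 - V) * E)]
  filter_upwards [eventually_ge_atTop ((m₀ + k) * a, m₀ * a)] with p hp
  obtain ⟨hp1, hp2⟩ := hp
  obtain ⟨n, hn⟩ := Nat.exists_eq_add_of_le hp1
  obtain ⟨m, hm⟩ := Nat.exists_eq_add_of_le hp2
  simp only at hn hm
  have hAa : A ^ a = T ^ ((m₀ + k) * a) * S ^ (m₀ * a) := by
    rw [hAdef, (hcTS.pow_pow _ _).mul_pow, ← pow_mul, ← pow_mul]
  have heq : T ^ p.1 * S ^ p.2 = A ^ a * (T ^ n * S ^ m) := by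
    rw [hn, hm, hAa, pow_add, pow_add, mul_assoc, mul_assoc, ← mul_assoc (T ^ n),
      (hcTS.pow_pow n (m₀ * a)).eq, mul_assoc]
  have heq2 : T ^ (p.1 + k) * S ^ p.2 - T ^ p.1 * S ^ p.2 =
      -((1 - V) * A ^ a * (T ^ n * S ^ m)) := by
    rw [mul_assoc, ← heq, add_comm, pow_add, ← hVdef]; noncomm_ring
  rw [heq2, norm_neg, dist_zero_right, norm_norm]
  refine lt_of_le_of_lt (norm_mul_le _ _) (lt_of_le_of_lt ?_ hkey)
  exact mul_le_of_le_one_right (norm_nonneg _)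
    (norm_mul_le_one (norm_pow_le_one hone hTnorm _) (norm_pow_le_one hone hSnorm _))
end
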